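/- Let α ∈ (0,1) be irrational with partial quotients a_k and convergent denominators q_k, let (n_ℓ)_{ℓ∈ℕ} be a strictly increasing sequence of even positive integers such that (Σ_{i=1}^{n_ℓ} a_i)/a_{n_ℓ+1} → 0, and let x₀ ∈ 𝕋 be such that q_{n_ℓ}·x₀ converges in 𝕋 to some x̄₀. Let s(x) = ι(x) − 1/2. Then sup_{c∈[0,1]} | S_{⌊c·a_{n_ℓ+1}⌋·q_{n_ℓ}}(s,α,x₀)/a_{n_ℓ+1} − (∫₀^c ι(y + x̄₀) dy − c/2) | → 0 as ℓ → ∞. -/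

import Mathlib

open MeasureTheory Filter Set Topology

noncomputable def toCircle (x : ℝ) : UnitAddCircle := x

/-- The canonical embedding `ι : 𝕋 → [0,1) ⊆ ℝ`. -/
noncomputable def iota (x : UnitAddCircle) : ℝ := (AddCircle.equivIco 1 0 x : ℝ)

/-- The Birkhoff sum `S_N(f, α, x₀) = ∑_{k=0}^{N-1} f(x₀ + kα)`. -/
noncomputable def birkhoff (f : UnitAddCircle → ℝ) (α x₀ : UnitAddCircle) (N : ℕ) : ℝ :=
  ∑ k ∈ Finset.range N, f (x₀ + k • α)

/-- Iterates of the Gauss map, starting from the fractional part of `α`. -/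
noncomputable def gaussIter (α : ℝ) : ℕ → ℝ
  | 0 => Int.fract α
  | n + 1 => Int.fract (1 / gaussIter α n)

/-- The `k`-th partial quotient `a_k(α)` (for `k ≥ 1`) of the continued fraction
expansion of `α`. -/
noncomputable def cfA (α : ℝ) (k : ℕ) : ℕ := ⌊1 / gaussIter α (k - 1)⌋₊

/-- The denominators `q_k(α)` of the convergents of `α`:
`q₀ = 1`, `q₁ = a₁`, `q_{k+1} = a_{k+1} q_k + q_{k-1}`. -/
noncomputable def cfQ (α : ℝ) : ℕ → ℕ
  | 0 => 1
  | 1 => cfA α 1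
  | (k + 2) => cfA α (k + 2) * cfQ α (k + 1) + cfQ α k

/-- The sum of `Int.fract` along a full period of a rational rotation by `p / q`. -/
lemma sum_fract_add_mul_div {q : ℕ} (hq : 0 < q) {p : ℤ} (hpq : IsCoprime p (q : ℤ)) (z : ℝ) :
    ∑ k ∈ Finset.range q, Int.fract (z + k * (p / q)) = Int.fract (q * z) + ((q : ℝ) - 1) / 2 := by
  have hq' : (0 : ℝ) < q := by exact_mod_cast hq
  have hqz : (0 : ℤ) < q := by exact_mod_cast hq
  set m : ℤ := ⌊q * z⌋
  have hterm : ∀ k : ℕ, Int.fract (z + k * (p / q)) =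
      (((m + k * p) % q).toNat : ℝ) / q + Int.fract (q * z) / q := by
    intro k
    have hnn : 0 ≤ (m + k * p) % q := Int.emod_nonneg _ hqz.ne'
    have hcast : (((m + k * p) % q).toNat : ℝ) = (((m + k * p) % q : ℤ) : ℝ) := by
      exact_mod_cast Int.toNat_of_nonneg hnn
    have hlt : (((m + k * p) % q : ℤ) : ℝ) + 1 ≤ q := by
      exact_mod_cast Int.emod_lt_of_pos (m + k * p) hqz
    have hnn' : (0 : ℝ) ≤ (((m + k * p) % q : ℤ) : ℝ) := by exact_mod_cast hnn
    have hf0 := Int.fract_nonneg ((q : ℝ) * z)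
    have hf1 := Int.fract_lt_one ((q : ℝ) * z)
    rw [hcast, Int.fract_eq_iff, ← add_div]
    refine ⟨by positivity, by rw [div_lt_one hq']; linarith, (m + k * p) / q, ?_⟩
    have hdiv : (((m + k * p) % q : ℤ) : ℝ) + q * (((m + k * p) / q : ℤ) : ℝ) = m + k * p := by
      exact_mod_cast Int.emod_add_mul_ediv (m + k * p) q
    have hfl : (m : ℝ) + Int.fract ((q : ℝ) * z) = q * z := Int.floor_add_fract _
    have hz : z = (m + Int.fract ((q : ℝ) * z)) / q := by rw [hfl]; field_simp
    have hd : (((m + k * p) / q : ℤ) : ℝ) = (m + k * p - (((m + k * p) % q : ℤ) : ℝ)) / q := by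
      rw [← hdiv]; field_simp; ring
    rw [hd]
    nth_rw 1 [hz]
    ring
  have hinj : Set.InjOn (fun k : ℕ => ((m + k * p) % q).toNat) (Finset.range q : Set ℕ) := by
    intro i hi j hj hij
    simp only [Finset.coe_range, Set.mem_Iio] at hi hj
    have h1 : (m + i * p) % q = (m + j * p) % q := by
      have hi' := Int.emod_nonneg (m + i * p) hqz.ne'
      have hj' := Int.emod_nonneg (m + j * p) hqz.ne'
      simp only at hij
      omega
    have h2 : (q : ℤ) ∣ (j - i) * p := by
      have := Int.ModEq.dvd h1
      convert this using 1
      ring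
    have h3 : (q : ℤ) ∣ j - i := hpq.symm.dvd_of_dvd_mul_right h2
    have h4 : ((i : ℤ)) % q = j % q := Int.modEq_iff_dvd.2 h3
    rw [Int.emod_eq_of_lt (by omega) (by omega), Int.emod_eq_of_lt (by omega) (by omega)] at h4
    exact_mod_cast h4
  have hmaps : Set.MapsTo (fun k : ℕ => ((m + k * p) % q).toNat)
      (Finset.range q : Set ℕ) (Finset.range q : Set ℕ) := by
    intro k _
    have := Int.emod_lt_of_pos (m + k * p) hqz
    have := Int.emod_nonneg (m + k * p) hqz.ne'
    simp only [Finset.coe_range, Set.mem_Iio]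
    omega
  have hperm : ∑ k ∈ Finset.range q, (((m + k * p) % q).toNat : ℝ) =
      ∑ k ∈ Finset.range q, (k : ℝ) :=
    Finset.sum_nbij (fun k : ℕ => ((m + k * p) % q).toNat) hmaps hinj
      (Finset.surjOn_of_injOn_of_card_le _ hmaps hinj le_rfl) fun _ _ => rfl
  have hgauss : ∑ k ∈ Finset.range q, (k : ℝ) = q * (q - 1) / 2 := by
    have h := Finset.sum_range_id_mul_two q
    have h' : (∑ k ∈ Finset.range q, (k : ℝ)) * 2 = q * (q - 1) := by
      rw [← Nat.cast_pred hq, ← Nat.cast_sum]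
      exact_mod_cast h
    linarith
  simp_rw [hterm]
  rw [Finset.sum_add_distrib, ← Finset.sum_div, hperm, hgauss, Finset.sum_const,
    Finset.card_range, nsmul_eq_mul]
  field_simp
  ring

/-- The sum of `Int.fract` along `q` steps of a rotation by `α`, slightly larger than `p / q`. -/
lemma abs_sum_fract_sub_le {q : ℕ} (hq : 0 < q) {p : ℤ} (hpq : IsCoprime p (q : ℤ)) {α : ℝ}
    (hη : 0 ≤ q * α - p) (y : ℝ) :
    |∑ k ∈ Finset.range q, (Int.fract (y + k * α) - 1 / 2) - (Int.fract (q * y) - 1 / 2)| ≤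
      q * (q * α - p) + ((⌊q * y + q * (q * α - p)⌋ : ℝ) - ⌊q * y⌋) := by
  have hq' : (0 : ℝ) < q := by exact_mod_cast hq
  set η : ℝ := q * α - p with hηdef
  have hα : α = p / q + η / q := by
    rw [hηdef]; field_simp; ring
  have h0 := sum_fract_add_mul_div hq hpq y
  have h1 := sum_fract_add_mul_div hq hpq (y + η)
  have hk : ∀ k ∈ Finset.range q, 0 ≤ k * (η / q) ∧ k * (η / q) ≤ η := by
    intro k hk
    have hk' : (k : ℝ) ≤ q := by exact_mod_cast (Finset.mem_range.1 hk).le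
    refine ⟨by positivity, ?_⟩
    rw [← mul_div_assoc, div_le_iff₀ hq', mul_comm η]
    gcongr
  have hlow : ∑ k ∈ Finset.range q, (⌊y + k * (p / q)⌋ : ℝ) ≤
      ∑ k ∈ Finset.range q, (⌊y + k * α⌋ : ℝ) := by
    refine Finset.sum_le_sum fun k hk' => ?_
    have : ⌊y + k * (p / q)⌋ ≤ ⌊y + k * α⌋ := by
      apply Int.floor_le_floor
      rw [hα]
      linarith [hk k hk']
    exact_mod_cast this
  have hupp : ∑ k ∈ Finset.range q, (⌊y + k * α⌋ : ℝ) ≤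
      ∑ k ∈ Finset.range q, (⌊y + η + k * (p / q)⌋ : ℝ) := by
    refine Finset.sum_le_sum fun k hk' => ?_
    have : ⌊y + k * α⌋ ≤ ⌊y + η + k * (p / q)⌋ := by
      apply Int.floor_le_floor
      rw [hα]
      linarith [hk k hk']
    exact_mod_cast this
  have hsum0 : 0 ≤ ∑ k ∈ Finset.range q, (k : ℝ) * (η / q) :=
    Finset.sum_nonneg fun k hk' => (hk k hk').1
  have hsum1 : ∑ k ∈ Finset.range q, (k : ℝ) * (η / q) ≤ q * η := by
    have := Finset.sum_le_card_nsmul _ _ _ fun k hk' => (hk k hk').2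
    simpa using this
  have hsα : ∑ k ∈ Finset.range q, (k : ℝ) * α =
      ∑ k ∈ Finset.range q, (k : ℝ) * (p / q) + ∑ k ∈ Finset.range q, (k : ℝ) * (η / q) := by
    rw [← Finset.sum_add_distrib]
    exact Finset.sum_congr rfl fun k _ => by rw [hα]; ring
  have hmono : (⌊q * y⌋ : ℝ) ≤ ⌊q * y + q * η⌋ := by
    have : ⌊q * y⌋ ≤ ⌊q * y + q * η⌋ := Int.floor_le_floor (by nlinarith)
    exact_mod_cast this
  rw [mul_add] at h1
  simp only [Int.fract, Finset.sum_sub_distrib, Finset.sum_add_distrib, Finset.sum_const,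
    Finset.card_range, nsmul_eq_mul] at h0 h1 ⊢
  rw [hsα, abs_le]
  constructor <;> linarith

/-- Comparison of a Birkhoff sum of length `M * q` with a sum of length `M` over the rotation by
`q * (q * α - p)`. -/
lemma abs_sum_fract_mul_sub_le {q : ℕ} (hq : 0 < q) {p : ℤ} (hpq : IsCoprime p (q : ℤ)) {α : ℝ}
    (hη : 0 ≤ q * α - p) (x : ℝ) (M : ℕ) :
    |∑ k ∈ Finset.range (M * q), (Int.fract (x + k * α) - 1 / 2) -
        ∑ j ∈ Finset.range M, (Int.fract (q * x + j * (q * (q * α - p))) - 1 / 2)| ≤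
      M * (q * (q * α - p)) + ((⌊q * x + M * (q * (q * α - p))⌋ : ℝ) - ⌊q * x⌋) := by
  induction M with
  | zero => simp
  | succ M ih =>
    have hb := abs_sum_fract_sub_le hq hpq hη (x + M * (q * α - p))
    rw [add_mul, one_mul, Finset.sum_range_add, Finset.sum_range_succ]
    have hshift : ∀ k : ℕ, Int.fract (x + ((M * q + k : ℕ) : ℝ) * α) =
        Int.fract (x + M * (q * α - p) + k * α) := by
      intro k
      rw [← Int.fract_add_intCast (x + M * (q * α - p) + k * α) (M * p)]
      congr 1
      push_cast
      ring
    simp_rw [hshift]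
    have e1 : (q : ℝ) * (x + M * (q * α - p)) = q * x + M * (q * (q * α - p)) := by ring
    have e2 : (q : ℝ) * x + ((M + 1 : ℕ) : ℝ) * (q * (q * α - p)) =
        q * x + M * (q * (q * α - p)) + q * (q * α - p) := by push_cast; ring
    rw [e1] at hb
    rw [e2]
    push_cast
    rw [abs_le] at ih hb ⊢
    constructor <;> linarith [ih.1, ih.2, hb.1, hb.2]

lemma intervalIntegrable_fract (a b : ℝ) :
    IntervalIntegrable (fun x : ℝ => Int.fract x) volume a b := by
  refine (intervalIntegrable_const (μ := volume) (a := a) (b := b) (c := (1 : ℝ))).mono_fun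
    measurable_fract.aestronglyMeasurable (Filter.Eventually.of_forall fun x => ?_)
  simp [abs_of_nonneg (Int.fract_nonneg x), (Int.fract_lt_one x).le]

lemma abs_integral_fract_le (a b : ℝ) : |∫ y in a..b, Int.fract y| ≤ |b - a| := by
  have := intervalIntegral.norm_integral_le_of_norm_le_const (a := a) (b := b) (C := 1)
    (f := fun y : ℝ => Int.fract y) (fun y _ => by
      simp [abs_of_nonneg (Int.fract_nonneg y), (Int.fract_lt_one y).le])
  simpa using this

/-- One step of a Riemann sum for `Int.fract`; a discontinuity costs at most the step length. -/
lemma abs_mul_fract_sub_integral_le {θ : ℝ} (hθ : 0 ≤ θ) (u : ℝ) :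
    |θ * Int.fract u - ∫ y in u..(u + θ), Int.fract y| ≤
      θ * (θ + ((⌊u + θ⌋ : ℝ) - ⌊u⌋)) := by
  have h : ∫ y in u..(u + θ), (Int.fract u - Int.fract y) =
      θ * Int.fract u - ∫ y in u..(u + θ), Int.fract y := by
    rw [intervalIntegral.integral_sub intervalIntegrable_const (intervalIntegrable_fract _ _)]
    simp
  rw [← h]
  have := intervalIntegral.norm_integral_le_of_norm_le_const (a := u) (b := u + θ)
    (C := θ + ((⌊u + θ⌋ : ℝ) - ⌊u⌋))
    (f := fun y : ℝ => Int.fract u - Int.fract y) (fun y hy => by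
      rw [Set.uIoc_of_le (by linarith)] at hy
      have h1 : (⌊u⌋ : ℝ) ≤ ⌊y⌋ := by exact_mod_cast Int.floor_le_floor hy.1.le
      have h2 : (⌊y⌋ : ℝ) ≤ ⌊u + θ⌋ := by exact_mod_cast Int.floor_le_floor hy.2
      rw [Real.norm_eq_abs, abs_le, Int.fract, Int.fract]
      constructor <;> linarith [hy.1, hy.2])
  rw [add_sub_cancel_left, abs_of_nonneg hθ, Real.norm_eq_abs] at this
  linarith

lemma abs_riemannSum_fract_sub_integral_le {θ : ℝ} (hθ : 0 ≤ θ) (u : ℝ) (M : ℕ) :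
    |θ * ∑ j ∈ Finset.range M, Int.fract (u + j * θ) - ∫ y in u..(u + M * θ), Int.fract y| ≤
      θ * (M * θ + ((⌊u + M * θ⌋ : ℝ) - ⌊u⌋)) := by
  induction M with
  | zero => simp
  | succ M ih =>
    have hs := abs_mul_fract_sub_integral_le hθ (u + M * θ)
    have e : u + ((M + 1 : ℕ) : ℝ) * θ = u + M * θ + θ := by push_cast; ring
    rw [e, Finset.sum_range_succ, mul_add,
      ← intervalIntegral.integral_add_adjacent_intervals
        (intervalIntegrable_fract u (u + M * θ)) (intervalIntegrable_fract _ _)]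
    push_cast
    rw [abs_le] at ih hs ⊢
    constructor <;> nlinarith [ih.1, ih.2, hs.1, hs.2]

/-- The integral of `Int.fract` over `[b, b + c]` depends on the endpoints in a Lipschitz way, and
on the base point only modulo `1`. -/
lemma abs_integral_fract_sub_integral_fract_le (u b s c : ℝ) (m : ℤ) :
    |(∫ y in u..(u + s), Int.fract y) - ∫ y in b..(b + c), Int.fract y| ≤
      2 * |u - b - m| + |s - c| := by
  have hper : ∫ y in b..(b + c), Int.fract y = ∫ y in (b + m)..(b + c + m), Int.fract y := by
    rw [← intervalIntegral.integral_comp_add_right]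
    simp
  rw [hper, intervalIntegral.integral_interval_sub_interval_comm (intervalIntegrable_fract _ _)
    (intervalIntegrable_fract _ _) (intervalIntegrable_fract _ _)]
  have h1 := abs_integral_fract_le u (b + m)
  have h2 := abs_integral_fract_le (u + s) (b + c + m)
  have h3 : |b + m - u| = |u - b - m| := by rw [← abs_neg]; congr 1; ring
  have h4 : |b + c + m - (u + s)| ≤ |u - b - m| + |s - c| := by
    rw [← abs_neg]
    refine le_trans (le_of_eq ?_) (abs_add_le _ _)
    congr 1; ring
  have h5 := abs_sub (∫ y in u..(b + m), Int.fract y) (∫ y in (u + s)..(b + c + m), Int.fract y)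
  linarith

/-- The numerators `p_k(α)` of the convergents of `α ∈ (0, 1)`. -/
noncomputable def cfP (α : ℝ) : ℕ → ℕ
  | 0 => 0
  | 1 => 1
  | (k + 2) => cfA α (k + 2) * cfP α (k + 1) + cfP α k

lemma irrational_gaussIter {α : ℝ} (hirr : Irrational α) (k : ℕ) : Irrational (gaussIter α k) := by
  induction k with
  | zero => exact hirr.sub_intCast _
  | succ k ih =>
    have h : Irrational (1 / gaussIter α k) := by simpa using ih
    exact h.sub_intCast _

lemma gaussIter_pos {α : ℝ} (hirr : Irrational α) (k : ℕ) : 0 < gaussIter α k := by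
  refine lt_of_le_of_ne ?_ (irrational_gaussIter hirr k).ne_zero.symm
  cases k <;> exact Int.fract_nonneg _

lemma gaussIter_lt_one (α : ℝ) (k : ℕ) : gaussIter α k < 1 := by
  cases k <;> exact Int.fract_lt_one _

lemma cfA_add_gaussIter {α : ℝ} (hirr : Irrational α) (k : ℕ) :
    (cfA α (k + 1) + gaussIter α (k + 1)) * gaussIter α k = 1 := by
  have hpos := gaussIter_pos hirr k
  have h : (cfA α (k + 1) : ℝ) = (⌊1 / gaussIter α k⌋ : ℝ) := by
    rw [cfA, Nat.add_sub_cancel]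
    exact natCast_floor_eq_intCast_floor (by positivity)
  rw [h, gaussIter, Int.floor_add_fract]
  field_simp

lemma one_le_cfA {α : ℝ} (hirr : Irrational α) (k : ℕ) : 1 ≤ cfA α (k + 1) := by
  rw [cfA, Nat.add_sub_cancel]
  apply Nat.le_floor
  rw [Nat.cast_one, le_div_iff₀ (gaussIter_pos hirr k)]
  linarith [gaussIter_lt_one α k]

lemma cfQ_succ_succ (α : ℝ) (k : ℕ) :
    cfQ α (k + 2) = cfA α (k + 2) * cfQ α (k + 1) + cfQ α k := rfl

lemma cfQ_pos {α : ℝ} (hirr : Irrational α) (k : ℕ) : 0 < cfQ α k := by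
  induction k using Nat.twoStepInduction with
  | zero => exact one_pos
  | one => exact one_le_cfA hirr 0
  | more k ih _ => rw [cfQ_succ_succ]; positivity

lemma cfQ_le_cfQ_succ {α : ℝ} (hirr : Irrational α) (k : ℕ) : cfQ α k ≤ cfQ α (k + 1) := by
  cases k with
  | zero => exact one_le_cfA hirr 0
  | succ k =>
    rw [cfQ_succ_succ]
    have := one_le_cfA hirr (k + 1)
    nlinarith [cfQ_pos hirr (k + 1)]

lemma cfP_mul_cfQ_sub (α : ℝ) (k : ℕ) :
    (cfP α (k + 1) : ℤ) * cfQ α k - cfP α k * cfQ α (k + 1) = (-1) ^ k := by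
  induction k with
  | zero => simp [cfP, cfQ]
  | succ k ih =>
    rw [cfP, cfQ, pow_succ, ← ih]
    push_cast
    ring

lemma isCoprime_cfP_cfQ (α : ℝ) (k : ℕ) : IsCoprime (cfP α k : ℤ) (cfQ α k : ℤ) := by
  have h := cfP_mul_cfQ_sub α k
  have hs : ((-1 : ℤ) ^ k) * (-1) ^ k = 1 := by rw [← mul_pow]; simp
  exact ⟨-(-1) ^ k * cfQ α (k + 1), (-1) ^ k * cfP α (k + 1), by
    linear_combination (-1) ^ k * h + hs⟩

lemma cfQ_mul_sub_cfP {α : ℝ} (hirr : Irrational α) (hα : α ∈ Set.Ioo (0 : ℝ) 1) (k : ℕ) :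
    cfQ α k * α - cfP α k = (-1) ^ k * ∏ i ∈ Finset.range (k + 1), gaussIter α i := by
  have h0 : gaussIter α 0 = α := Int.fract_eq_self.2 ⟨hα.1.le, hα.2⟩
  induction k using Nat.twoStepInduction with
  | zero => simp [cfQ, cfP, h0]
  | one =>
    have h := cfA_add_gaussIter hirr 0
    simp only [zero_add, h0] at h
    simp only [cfQ, cfP, Finset.prod_range_succ, Finset.prod_range_zero, h0]
    push_cast
    linarith
  | more k ih ih' =>
    have h := cfA_add_gaussIter hirr (k + 1)
    rw [Finset.prod_range_succ] at ih'
    rw [Finset.prod_range_succ, Finset.prod_range_succ, cfQ, cfP]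
    push_cast
    set P := ∏ i ∈ Finset.range (k + 1), gaussIter α i
    linear_combination cfA α (k + 2) * ih' + ih - (-1) ^ k * P * h

lemma cfQ_succ_mul_prod_add {α : ℝ} (hirr : Irrational α) (k : ℕ) :
    cfQ α (k + 1) * ∏ i ∈ Finset.range (k + 1), gaussIter α i +
      cfQ α k * ∏ i ∈ Finset.range (k + 2), gaussIter α i = 1 := by
  induction k with
  | zero =>
    have h := cfA_add_gaussIter hirr 0
    simp only [cfQ, Finset.prod_range_succ, Finset.prod_range_zero]
    push_cast
    linarith
  | succ k ih =>
    have h := cfA_add_gaussIter hirr (k + 1)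
    rw [Finset.prod_range_succ _ (k + 1)] at ih
    rw [Finset.prod_range_succ _ (k + 2), Finset.prod_range_succ _ (k + 1), cfQ]
    push_cast
    set P := ∏ i ∈ Finset.range (k + 1), gaussIter α i
    linear_combination ih + cfQ α (k + 1) * P * h

/-- At an even index `n`, the convergent lies below `α`, and `q_n (q_n α - p_n)` is close to
`1 / a_{n+1}`. -/
lemma cfQ_mul_error_bounds {α : ℝ} (hirr : Irrational α) (hα : α ∈ Set.Ioo (0 : ℝ) 1) {n : ℕ}
    (heven : Even n) (hpos : 0 < n) :
    0 < cfQ α n * α - cfP α n ∧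
      cfA α (n + 1) * (cfQ α n * (cfQ α n * α - cfP α n)) ≤ 1 ∧
      1 - cfA α (n + 1) * (cfQ α n * (cfQ α n * α - cfP α n)) ≤
        2 * (cfQ α n * (cfQ α n * α - cfP α n)) := by
  obtain ⟨k, rfl⟩ := Nat.exists_eq_succ_of_ne_zero hpos.ne'
  have h1 := cfQ_mul_sub_cfP hirr hα (k + 1)
  rw [heven.neg_one_pow, one_mul] at h1
  have h2 := cfQ_succ_mul_prod_add hirr (k + 1)
  rw [Finset.prod_range_succ _ (k + 2), cfQ] at h2
  simp only [Nat.succ_eq_add_one]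
  rw [h1]
  push_cast at h2
  have hP : 0 < ∏ i ∈ Finset.range (k + 1 + 1), gaussIter α i :=
    Finset.prod_pos fun i _ => gaussIter_pos hirr i
  set P := ∏ i ∈ Finset.range (k + 1 + 1), gaussIter α i
  have hg := gaussIter_pos hirr (k + 2)
  have hg1 := gaussIter_lt_one α (k + 2)
  have hqq : (cfQ α k : ℝ) ≤ cfQ α (k + 1) := by exact_mod_cast cfQ_le_cfQ_succ hirr k
  have e1 : 0 ≤ (cfQ α k : ℝ) * P := by positivity
  have e2 : 0 ≤ (cfQ α (k + 1) : ℝ) * (P * gaussIter α (k + 2)) := by positivity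
  have e3 : (cfQ α k : ℝ) * P ≤ cfQ α (k + 1) * P := by gcongr
  have e4 : (cfQ α (k + 1) : ℝ) * (P * gaussIter α (k + 2)) ≤ cfQ α (k + 1) * P := by
    gcongr
    nlinarith
  exact ⟨hP, by linarith, by linarith⟩

lemma iota_coe (x : ℝ) : iota (x : UnitAddCircle) = Int.fract x := by
  have h := AddCircle.coe_equivIco_mk_apply (1 : ℝ) x
  rw [div_one, mul_one] at h
  exact h

lemma birkhoff_sawtooth_coe (α x : ℝ) (N : ℕ) :
    birkhoff (fun x => iota x - 1 / 2) (toCircle α) (x : UnitAddCircle) N =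
      ∑ k ∈ Finset.range N, (Int.fract (x + k * α) - 1 / 2) := by
  refine Finset.sum_congr rfl fun k _ => ?_
  rw [← iota_coe]
  simp [toCircle]

lemma integral_iota_toCircle_add (b c : ℝ) :
    ∫ y in (0 : ℝ)..c, iota (toCircle y + (b : UnitAddCircle)) =
      ∫ y in b..(b + c), Int.fract y := by
  have h : ∀ y : ℝ, iota (toCircle y + (b : UnitAddCircle)) = Int.fract (y + b) := fun y => by
    rw [← iota_coe]
    simp [toCircle]
  simp_rw [h]
  rw [intervalIntegral.integral_comp_add_right (fun y => Int.fract y), zero_add, add_comm c b]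

lemma floor_add_sub_floor_le (u t : ℝ) : (⌊u + t⌋ : ℝ) - ⌊u⌋ ≤ t + 1 := by
  linarith [Int.floor_le (u + t), Int.lt_floor_add_one u]

/-- Quantitative form of the profile convergence, for a rational approximation `p / q` of `α` from
below with error about `1 / (a q ^ 2)`. -/
lemma abs_sum_fract_div_sub_le {q : ℕ} (hq : 0 < q) {p : ℤ} (hpq : IsCoprime p (q : ℤ)) {α : ℝ}
    (hη : 0 ≤ q * α - p) {a : ℕ} (ha : 0 < a) (hle : a * (q * (q * α - p)) ≤ 1)
    (hge : 1 - a * (q * (q * α - p)) ≤ 2 * (q * (q * α - p))) (x b : ℝ) (m : ℤ) {c : ℝ}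
    (hc0 : 0 ≤ c) (hc1 : c ≤ 1) :
    |(∑ k ∈ Finset.range (⌊c * a⌋₊ * q), (Int.fract (x + k * α) - 1 / 2)) / a -
        ((∫ y in b..(b + c), Int.fract y) - c / 2)| ≤ 2 * |q * x - b - m| + 12 / a := by
  have ha' : (0 : ℝ) < a := by exact_mod_cast ha
  have hM1 : ((⌊c * a⌋₊ : ℕ) : ℝ) ≤ c * a := Nat.floor_le (by positivity)
  have hM2 : c * a < (⌊c * a⌋₊ : ℕ) + 1 := Nat.lt_floor_add_one _
  set M : ℕ := ⌊c * a⌋₊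
  have hS := abs_sum_fract_mul_sub_le hq hpq hη x M
  set θ : ℝ := q * (q * α - p)
  have hθ : 0 ≤ θ := by positivity
  have hR := abs_riemannSum_fract_sub_integral_le hθ (q * x) M
  have hI := abs_integral_fract_sub_integral_fract_le (q * x) b (M * θ) c m
  have hfl := floor_add_sub_floor_le (q * x) (M * θ)
  set S := ∑ k ∈ Finset.range (M * q), (Int.fract (x + k * α) - 1 / 2)
  rw [Finset.sum_sub_distrib, Finset.sum_const, Finset.card_range, nsmul_eq_mul] at hS
  set F := ∑ j ∈ Finset.range M, Int.fract (q * x + j * θ)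
  have hF0 : 0 ≤ F := Finset.sum_nonneg fun j _ => Int.fract_nonneg _
  have hFM : F ≤ M := by
    have := Finset.sum_le_card_nsmul (Finset.range M) (fun j : ℕ => Int.fract (q * x + j * θ)) 1
      fun j _ => (Int.fract_lt_one _).le
    simpa using this
  set I := ∫ y in (q * x)..(q * x + M * θ), Int.fract y
  set J := ∫ y in b..(b + c), Int.fract y
  have hMa : (M : ℝ) ≤ a := by nlinarith
  have hMθ : M * θ ≤ 1 := le_trans (by gcongr) hle
  obtain ⟨r, hr⟩ : ∃ r : ℝ, r = 1 / a := ⟨_, rfl⟩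
  have hr0 : 0 < r := by rw [hr]; positivity
  have har : a * r = 1 := by rw [hr]; field_simp
  have hθr : θ ≤ r := by nlinarith
  have hrθ : ∀ t : ℝ, 0 ≤ t → t ≤ a → 0 ≤ t * (r - θ) ∧ t * (r - θ) ≤ 2 * r := by
    intro t ht hta
    have h1 : 0 ≤ r - θ := by linarith
    refine ⟨mul_nonneg ht h1, ?_⟩
    have h2 : t * (r - θ) ≤ a * (r - θ) := by gcongr
    nlinarith
  have hFr := hrθ F hF0 (hFM.trans hMa)
  have hMr := hrθ M (by positivity) hMa
  have hS' : |S - (F - M * (1 / 2))| * r ≤ 3 * r := by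
    gcongr
    linarith
  rw [← abs_of_pos hr0, ← abs_mul, abs_of_pos hr0] at hS'
  have hR' : |θ * F - I| ≤ 3 * r := by
    refine hR.trans ?_
    have : θ * (M * θ + ((⌊q * x + M * θ⌋ : ℝ) - ⌊q * x⌋)) ≤ θ * 3 := by
      gcongr
      linarith
    linarith
  have hMc : c - r ≤ M * r ∧ M * r ≤ c := by
    have hc : c * a * r = c := by rw [mul_assoc, har, mul_one]
    have h1 : M * r ≤ c * a * r := by gcongr
    have h2 : c * a * r ≤ (M + 1) * r := by gcongr
    constructor <;> linarith
  have hI' : |M * θ - c| ≤ 3 * r := by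
    rw [mul_sub] at hMr
    rw [abs_le]
    constructor <;> linarith [hMr.1, hMr.2, hMc.1, hMc.2]
  have e1 : S / a = S * r := by rw [hr]; ring
  have e2 : (12 : ℝ) / a = 12 * r := by rw [hr]; ring
  rw [e1, e2]
  have hI'' := hI.trans (add_le_add_right hI' _)
  obtain ⟨hS₁, hS₂⟩ := abs_le.1 hS'
  obtain ⟨hR₁, hR₂⟩ := abs_le.1 hR'
  obtain ⟨hI₁, hI₂⟩ := abs_le.1 hI''
  obtain ⟨hF₁, hF₂⟩ := hFr
  obtain ⟨hM₁, hM₂⟩ := hMc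
  rw [mul_sub] at hF₁ hF₂
  have e3 : (S - (F - M * (1 / 2))) * r = S * r - F * r + M * r / 2 := by ring
  rw [e3] at hS₁ hS₂
  rw [mul_comm θ F] at hR₁ hR₂
  rw [abs_le]
  constructor <;> linarith

lemma exists_int_abs_sub_sub_eq_norm (u b : ℝ) :
    ∃ m : ℤ, |u - b - m| = ‖(u : UnitAddCircle) - (b : UnitAddCircle)‖ :=
  ⟨round (u - b), by rw [← AddCircle.coe_sub, UnitAddCircle.norm_eq]⟩

/-- Along a sequence of even indices `n_ℓ` with `(∑_{i≤n_ℓ} a_i)/a_{n_ℓ+1} → 0` and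
`q_{n_ℓ} x₀ → x̄₀`, the normalized Birkhoff sums of the sawtooth `s(x) = ι(x) - 1/2`
converge uniformly in `c ∈ [0,1]` to `∫₀^c ι(y + x̄₀) dy - c/2`. -/
theorem sawtooth_profile_convergence (α : ℝ) (hirr : Irrational α) (hα : α ∈ Set.Ioo (0:ℝ) 1)
    (n : ℕ → ℕ) (hmono : StrictMono n) (heven : ∀ ℓ, Even (n ℓ)) (hpos : ∀ ℓ, 0 < n ℓ)
    (hsum : Filter.Tendsto
      (fun ℓ => (∑ i ∈ Finset.Icc 1 (n ℓ), (cfA α i : ℝ)) / (cfA α (n ℓ + 1)))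
      Filter.atTop (nhds 0))
    (x₀ xbar : UnitAddCircle)
    (hx : Filter.Tendsto (fun ℓ => (cfQ α (n ℓ)) • x₀) Filter.atTop (nhds xbar)) :
    Filter.Tendsto (fun ℓ => ⨆ c : Set.Icc (0:ℝ) 1,
      |birkhoff (fun x => iota x - 1/2) (toCircle α) x₀
          (⌊(c : ℝ) * (cfA α (n ℓ + 1) : ℝ)⌋₊ * cfQ α (n ℓ)) / (cfA α (n ℓ + 1) : ℝ)
        - ((∫ y in (0:ℝ)..(c : ℝ), iota (toCircle y + xbar)) - (c : ℝ) / 2)|)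
      Filter.atTop (nhds 0) := by
  obtain ⟨x, rfl⟩ := QuotientAddGroup.mk_surjective x₀
  obtain ⟨b, rfl⟩ := QuotientAddGroup.mk_surjective xbar
  have hbound : ∀ ℓ, ∀ c : Set.Icc (0 : ℝ) 1,
      |birkhoff (fun x => iota x - 1/2) (toCircle α) (x : UnitAddCircle)
          (⌊(c : ℝ) * (cfA α (n ℓ + 1) : ℝ)⌋₊ * cfQ α (n ℓ)) / (cfA α (n ℓ + 1) : ℝ)
        - ((∫ y in (0:ℝ)..(c : ℝ), iota (toCircle y + (b : UnitAddCircle))) - (c : ℝ) / 2)| ≤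
      2 * ‖cfQ α (n ℓ) • (x : UnitAddCircle) - (b : UnitAddCircle)‖ +
        12 * ((∑ i ∈ Finset.Icc 1 (n ℓ), (cfA α i : ℝ)) / (cfA α (n ℓ + 1))) := by
    intro ℓ c
    obtain ⟨h1, h2, h3⟩ := cfQ_mul_error_bounds hirr hα (heven ℓ) (hpos ℓ)
    obtain ⟨m, hm⟩ := exists_int_abs_sub_sub_eq_norm (cfQ α (n ℓ) * x) b
    have hcoe : ((cfQ α (n ℓ) * x : ℝ) : UnitAddCircle) = cfQ α (n ℓ) • (x : UnitAddCircle) := by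
      rw [← nsmul_eq_mul, AddCircle.coe_nsmul]
    rw [hcoe] at hm
    have key := abs_sum_fract_div_sub_le (cfQ_pos hirr (n ℓ)) (isCoprime_cfP_cfQ α (n ℓ))
      (by exact_mod_cast h1.le) (one_le_cfA hirr (n ℓ)) (by exact_mod_cast h2)
      (by exact_mod_cast h3) x b m c.2.1 c.2.2
    rw [birkhoff_sawtooth_coe, integral_iota_toCircle_add]
    refine key.trans ?_
    have hone : (1 : ℝ) ≤ ∑ i ∈ Finset.Icc 1 (n ℓ), (cfA α i : ℝ) := by
      have h11 : (1 : ℝ) ≤ cfA α 1 := by exact_mod_cast one_le_cfA hirr 0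
      exact h11.trans (Finset.single_le_sum (f := fun i => (cfA α i : ℝ))
        (fun _ _ => Nat.cast_nonneg _) (Finset.mem_Icc.2 ⟨le_rfl, hpos ℓ⟩))
    rw [hm, mul_div_assoc']
    gcongr
    linarith
  have hlim : Filter.Tendsto (fun ℓ =>
      2 * ‖cfQ α (n ℓ) • (x : UnitAddCircle) - (b : UnitAddCircle)‖ +
        12 * ((∑ i ∈ Finset.Icc 1 (n ℓ), (cfA α i : ℝ)) / (cfA α (n ℓ + 1))))
      Filter.atTop (nhds 0) := by
    have h := ((tendsto_iff_norm_sub_tendsto_zero.1 hx).const_mul 2).add (hsum.const_mul 12)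
    simpa using h
  refine squeeze_zero (fun ℓ => Real.iSup_nonneg fun _ => abs_nonneg _) (fun ℓ => ?_) hlim
  have : Nonempty (Set.Icc (0 : ℝ) 1) := ⟨⟨0, by simp⟩⟩
  exact ciSup_le (hbound ℓ)
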